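/- For all N ≥ 1, β > 0 and t ∈ [0,1], 0 ≤ E⟨R(σ,τ)²⟩_t − E⟨R⁻(σ,τ)²⟩_t ≤ (2/N)·E⟨R(σ¹,σ²)²⟩, where ⟨·⟩ is the Gibbs average of the original single SK system at inverse temperature β. -/

import Mathlib

open MeasureTheory ProbabilityTheory Real Finset Filter

noncomputable section

/-- Spin configurations: each of the `N` sites carries a `±1` spin, encoded by a `Bool`. -/
abbrev Config (N : ℕ) := Fin N → Bool

/-- The `±1` value of a spin. -/
def spin (b : Bool) : ℝ := if b then 1 else -1

/-- The value of the last spin `σ_N` (junk value `0` when `N = 0`). -/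
def spinLast {N : ℕ} (σ : Config N) : ℝ :=
  if h : 0 < N then spin (σ ⟨N - 1, Nat.sub_lt h Nat.one_pos⟩) else 0

/-- The Gaussian disorder: i.i.d. standard Gaussians indexed by pairs `(i, j)`
(only the entries with `i < j` are used). -/
def gaussPi (N : ℕ) : Measure (Fin N × Fin N → ℝ) :=
  Measure.pi fun _ => gaussianReal 0 1

instance (N : ℕ) : IsProbabilityMeasure (gaussPi N) := by
  unfold gaussPi; infer_instance

/-- Three independent copies `g, g', g''` of the disorder. -/
def disM3 (N : ℕ) :
    Measure ((Fin N × Fin N → ℝ) × (Fin N × Fin N → ℝ) × (Fin N × Fin N → ℝ)) :=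
  (gaussPi N).prod ((gaussPi N).prod (gaussPi N))

/-- The SK Hamiltonian `H_{N,β}(σ) = (β/√N) ∑_{i<j} g_{ij} σ_i σ_j`. -/
def ham (N : ℕ) (β : ℝ) (g : Fin N × Fin N → ℝ) (σ : Config N) : ℝ :=
  (β / Real.sqrt N) *
    ∑ p ∈ Finset.univ.filter (fun p : Fin N × Fin N => p.1 < p.2),
      g p * spin (σ p.1) * spin (σ p.2)

/-- The cavity Hamiltonian `H⁻_N(σ) = (β/√N) ∑_{i<j<N} g_{ij} σ_i σ_j` on the first
`N - 1` spins. -/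
def hamCav (N : ℕ) (β : ℝ) (g : Fin N × Fin N → ℝ) (σ : Config N) : ℝ :=
  (β / Real.sqrt N) *
    ∑ p ∈ Finset.univ.filter
        (fun p : Fin N × Fin N => p.1 < p.2 ∧ (p.2 : ℕ) < N - 1),
      g p * spin (σ p.1) * spin (σ p.2)

/-- The overlap `R(σ¹,σ²) = (1/N) ∑_{i ≤ N} σ_i¹ σ_i²`. -/
def ovlp (N : ℕ) (σ τ : Config N) : ℝ := (∑ i, spin (σ i) * spin (τ i)) / N

/-- The truncated overlap `R⁻(σ¹,σ²) = (1/N) ∑_{i ≤ N−1} σ_i¹ σ_i²`. -/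
def ovlpm (N : ℕ) (σ τ : Config N) : ℝ :=
  (∑ i ∈ Finset.univ.filter (fun i : Fin N => (i : ℕ) < N - 1),
    spin (σ i) * spin (τ i)) / N

/-- The partition function `Z_N(β)`. -/
def partFun (N : ℕ) (β : ℝ) (g : Fin N × Fin N → ℝ) : ℝ :=
  ∑ σ : Config N, Real.exp (ham N β g σ)

/-- The free energy `F_N(β) = ln Z_N(β)`. -/
def freeEnergy (N : ℕ) (β : ℝ) (g : Fin N × Fin N → ℝ) : ℝ :=
  Real.log (partFun N β g)

/-- Two-replica Gibbs average `⟨f⟩` for the single SK system. -/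
def gibbs2 (N : ℕ) (β : ℝ) (g : Fin N × Fin N → ℝ)
    (f : Config N → Config N → ℝ) : ℝ :=
  (∑ σ : Config N, ∑ τ : Config N,
    f σ τ * Real.exp (ham N β g σ + ham N β g τ)) / (partFun N β g) ^ 2

/-- Disorder expectation of the two-replica Gibbs average. -/
def Egibbs2 (N : ℕ) (β : ℝ) (f : Config N → Config N → ℝ) : ℝ :=
  ∫ g, gibbs2 N β g f ∂gaussPi N

/-- The interpolated Hamiltonian `√t · H_N + √(1−t) · H'_N`. -/
def hamT (N : ℕ) (β t : ℝ) (g g' : Fin N × Fin N → ℝ) (σ : Config N) : ℝ :=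
  Real.sqrt t * ham N β g σ + Real.sqrt (1 - t) * ham N β g' σ

/-- The coupled Gibbs weight `exp(H¹_{N,t}(σ) + H²_{N,t}(τ))`. -/
def wT (N : ℕ) (β t : ℝ) (g g' g'' : Fin N × Fin N → ℝ)
    (ρ : Config N × Config N) : ℝ :=
  Real.exp (hamT N β t g g' ρ.1 + hamT N β t g g'' ρ.2)

/-- The coupled Gibbs average `⟨f⟩_t` of a function of one pair `(σ, τ)`. -/
def gibbsT (N : ℕ) (β t : ℝ) (g g' g'' : Fin N × Fin N → ℝ)
    (f : Config N × Config N → ℝ) : ℝ :=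
  (∑ ρ : Config N × Config N, f ρ * wT N β t g g' g'' ρ) /
    (∑ ρ : Config N × Config N, wT N β t g g' g'' ρ)

/-- The coupled Gibbs average `⟨f⟩_t` of a function of two pairs. -/
def gibbsT2 (N : ℕ) (β t : ℝ) (g g' g'' : Fin N × Fin N → ℝ)
    (f : Config N × Config N → Config N × Config N → ℝ) : ℝ :=
  (∑ ρ₁ : Config N × Config N, ∑ ρ₂ : Config N × Config N,
    f ρ₁ ρ₂ * wT N β t g g' g'' ρ₁ * wT N β t g g' g'' ρ₂) /
    (∑ ρ : Config N × Config N, wT N β t g g' g'' ρ) ^ 2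

/-- Disorder expectation `E⟨f⟩_t` (one pair). -/
def EgibbsT (N : ℕ) (β t : ℝ) (f : Config N × Config N → ℝ) : ℝ :=
  ∫ ω, gibbsT N β t ω.1 ω.2.1 ω.2.2 f ∂disM3 N

/-- Disorder expectation `E⟨f⟩_t` (two pairs). -/
def EgibbsT2 (N : ℕ) (β t : ℝ)
    (f : Config N × Config N → Config N × Config N → ℝ) : ℝ :=
  ∫ ω, gibbsT2 N β t ω.1 ω.2.1 ω.2.2 f ∂disM3 N

/-- The `s`-dependent cavity field term
`(β/√N) σ_N ∑_{i<N} (√t g_{iN} + √(1−t) g'_{iN}) σ_i`. -/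
def cavField (N : ℕ) (β t : ℝ) (g g' : Fin N × Fin N → ℝ) (σ : Config N) : ℝ :=
  if h : 0 < N then
    (β / Real.sqrt N) * spin (σ ⟨N - 1, Nat.sub_lt h Nat.one_pos⟩) *
      ∑ i ∈ Finset.univ.filter (fun i : Fin N => (i : ℕ) < N - 1),
        (Real.sqrt t * g (i, ⟨N - 1, Nat.sub_lt h Nat.one_pos⟩) +
          Real.sqrt (1 - t) * g' (i, ⟨N - 1, Nat.sub_lt h Nat.one_pos⟩)) * spin (σ i)
  else 0

/-- The cavity-interpolated Hamiltonian `H^1_{N,t,s}` (resp. `H^2_{N,t,s}` with `g''`). -/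
def hamTS (N : ℕ) (β t s : ℝ) (g g' : Fin N × Fin N → ℝ) (σ : Config N) : ℝ :=
  Real.sqrt t * hamCav N β g σ + Real.sqrt (1 - t) * hamCav N β g' σ +
    Real.sqrt s * cavField N β t g g' σ

/-- The coupled cavity Gibbs weight `exp(H¹_{N,t,s}(σ) + H²_{N,t,s}(τ))`. -/
def wTS (N : ℕ) (β t s : ℝ) (g g' g'' : Fin N × Fin N → ℝ)
    (ρ : Config N × Config N) : ℝ :=
  Real.exp (hamTS N β t s g g' ρ.1 + hamTS N β t s g g'' ρ.2)

/-- The coupled cavity Gibbs average `⟨f⟩_{t,s}` of a function of one pair. -/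
def gibbsTS1 (N : ℕ) (β t s : ℝ) (g g' g'' : Fin N × Fin N → ℝ)
    (f : Config N × Config N → ℝ) : ℝ :=
  (∑ ρ : Config N × Config N, f ρ * wTS N β t s g g' g'' ρ) /
    (∑ ρ : Config N × Config N, wTS N β t s g g' g'' ρ)

/-- The coupled cavity Gibbs average `⟨f⟩_{t,s}` of a function of two pairs. -/
def gibbsTS2 (N : ℕ) (β t s : ℝ) (g g' g'' : Fin N × Fin N → ℝ)
    (f : Config N × Config N → Config N × Config N → ℝ) : ℝ :=
  (∑ ρ₁ : Config N × Config N, ∑ ρ₂ : Config N × Config N,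
    f ρ₁ ρ₂ * wTS N β t s g g' g'' ρ₁ * wTS N β t s g g' g'' ρ₂) /
    (∑ ρ : Config N × Config N, wTS N β t s g g' g'' ρ) ^ 2

/-- The coupled cavity Gibbs average `⟨f⟩_{t,s}` of a function of `n` pairs. -/
def gibbsTSn (N : ℕ) (β t s : ℝ) (g g' g'' : Fin N × Fin N → ℝ) {n : ℕ}
    (f : (Fin n → Config N × Config N) → ℝ) : ℝ :=
  (∑ ρ : Fin n → Config N × Config N, f ρ * ∏ l, wTS N β t s g g' g'' (ρ l)) /
    (∑ ρ₀ : Config N × Config N, wTS N β t s g g' g'' ρ₀) ^ n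

/-- Disorder expectation `E⟨f⟩_{t,s}` (one pair). -/
def EgibbsTS1 (N : ℕ) (β t s : ℝ) (f : Config N × Config N → ℝ) : ℝ :=
  ∫ ω, gibbsTS1 N β t s ω.1 ω.2.1 ω.2.2 f ∂disM3 N

/-- Disorder expectation `E⟨f⟩_{t,s}` (two pairs). -/
def EgibbsTS2 (N : ℕ) (β t s : ℝ)
    (f : Config N × Config N → Config N × Config N → ℝ) : ℝ :=
  ∫ ω, gibbsTS2 N β t s ω.1 ω.2.1 ω.2.2 f ∂disM3 N

/-- Disorder expectation `E⟨f⟩_{t,s}` (`n` pairs). -/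
def EgibbsTSn (N : ℕ) (β t s : ℝ) {n : ℕ}
    (f : (Fin n → Config N × Config N) → ℝ) : ℝ :=
  ∫ ω, gibbsTSn N β t s ω.1 ω.2.1 ω.2.2 f ∂disM3 N

/-- The covariance kernel `U(ρ, ρ')` of the `s`-part of the coupled cavity Hamiltonians. -/
def Ufun (N : ℕ) (β t : ℝ) (ρ ρ' : Config N × Config N) : ℝ :=
  β ^ 2 / 2 * (spinLast ρ.1 * spinLast ρ'.1 * ovlpm N ρ.1 ρ'.1 +
      spinLast ρ.2 * spinLast ρ'.2 * ovlpm N ρ.2 ρ'.2) +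
    β ^ 2 * t / 2 * (spinLast ρ.1 * spinLast ρ'.2 * ovlpm N ρ.1 ρ'.2 +
      spinLast ρ.2 * spinLast ρ'.1 * ovlpm N ρ.2 ρ'.1)

/-- `ν(β) = −(1/2)·ln(1 − β²) − β²/2`. -/
def nuSK (b : ℝ) : ℝ := -(1 / 2) * Real.log (1 - b ^ 2) - b ^ 2 / 2

lemma spin_mul_self (b : Bool) : spin b * spin b = 1 := by
  cases b <;> simp [spin]

lemma abs_spin (b : Bool) : |spin b| = 1 := by
  cases b <;> simp [spin]

lemma partFun_pos (N : ℕ) (β : ℝ) (g : Fin N × Fin N → ℝ) : 0 < partFun N β g :=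
  Finset.sum_pos (fun _ _ => Real.exp_pos _) Finset.univ_nonempty

lemma continuous_ham (N : ℕ) (β : ℝ) (σ : Config N) : Continuous fun g => ham N β g σ := by
  unfold ham
  fun_prop

/-- The two-point function `⟨σ_i σ_j⟩` of the single SK system. -/
def pairCorr (N : ℕ) (β : ℝ) (g : Fin N × Fin N → ℝ) (i j : Fin N) : ℝ :=
  (∑ σ : Config N, spin (σ i) * spin (σ j) * Real.exp (ham N β g σ)) / partFun N β g

lemma continuous_pairCorr (N : ℕ) (β : ℝ) (i j : Fin N) :
    Continuous fun g => pairCorr N β g i j := by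
  have h := continuous_ham N β
  refine Continuous.div ?_ ?_ fun g => (partFun_pos N β g).ne'
  · fun_prop
  · unfold partFun
    fun_prop

lemma pairCorr_self (N : ℕ) (β : ℝ) (g : Fin N × Fin N → ℝ) (i : Fin N) :
    pairCorr N β g i i = 1 := by
  simp only [pairCorr, spin_mul_self, one_mul]
  exact div_self (partFun_pos N β g).ne'

lemma pairCorr_comm (N : ℕ) (β : ℝ) (g : Fin N × Fin N → ℝ) (i j : Fin N) :
    pairCorr N β g i j = pairCorr N β g j i := by
  unfold pairCorr
  congr 1
  exact Finset.sum_congr rfl fun σ _ => by rw [mul_comm (spin (σ i))]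

lemma abs_pairCorr_le_one (N : ℕ) (β : ℝ) (g : Fin N × Fin N → ℝ) (i j : Fin N) :
    |pairCorr N β g i j| ≤ 1 := by
  rw [pairCorr, abs_div, abs_of_pos (partFun_pos N β g), div_le_one (partFun_pos N β g)]
  refine (Finset.abs_sum_le_sum_abs _ _).trans (Finset.sum_le_sum fun σ _ => ?_)
  simp [abs_mul, abs_spin]

/-- The relabelling of pairs of sites induced by a permutation of the sites, swapping the two
entries when needed to preserve the relation `p.1 < p.2`. -/
def pairRelabel {N : ℕ} (e : Equiv.Perm (Fin N)) (p : Fin N × Fin N) : Fin N × Fin N :=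
  if p.1 < p.2 ↔ e p.1 < e p.2 then (e p.1, e p.2) else (e p.2, e p.1)

lemma pairRelabel_lt_iff {N : ℕ} (e : Equiv.Perm (Fin N)) (p : Fin N × Fin N) :
    (pairRelabel e p).1 < (pairRelabel e p).2 ↔ p.1 < p.2 := by
  have h : e p.1 = e p.2 ↔ p.1 = p.2 := e.injective.eq_iff
  unfold pairRelabel
  split_ifs <;> grind

lemma pairRelabel_symm_pairRelabel {N : ℕ} (e : Equiv.Perm (Fin N)) (p : Fin N × Fin N) :
    pairRelabel e.symm (pairRelabel e p) = p := by
  obtain ⟨i, j⟩ := p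
  have hij : e i = e j ↔ i = j := e.injective.eq_iff
  by_cases hp : i < j ↔ e i < e j
  · simp [pairRelabel, hp]
  · have hq : ¬ (e j < e i ↔ j < i) := by grind
    simp [pairRelabel, hp, hq]

/-- `pairRelabel` as a permutation of the set of pairs. -/
def pairRelabelEquiv {N : ℕ} (e : Equiv.Perm (Fin N)) : Equiv.Perm (Fin N × Fin N) where
  toFun := pairRelabel e
  invFun := pairRelabel e.symm
  left_inv := pairRelabel_symm_pairRelabel e
  right_inv := pairRelabel_symm_pairRelabel e.symm

lemma ham_relabel (N : ℕ) (β : ℝ) (g : Fin N × Fin N → ℝ) (e : Equiv.Perm (Fin N))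
    (σ : Config N) : ham N β (g ∘ pairRelabelEquiv e) (σ ∘ e) = ham N β g σ := by
  unfold ham
  congr 1
  refine Finset.sum_equiv (pairRelabelEquiv e) (fun p => ?_) fun p _ => ?_
  · simpa [pairRelabelEquiv] using (pairRelabel_lt_iff e p).symm
  · simp only [Function.comp_apply, pairRelabelEquiv, Equiv.coe_fn_mk]
    rw [mul_assoc, mul_assoc]
    congr 1
    unfold pairRelabel
    split_ifs
    · rfl
    · exact mul_comm _ _

lemma sum_comp_perm {N : ℕ} (e : Equiv.Perm (Fin N)) (F : Config N → ℝ) :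
    ∑ σ : Config N, F (σ ∘ e) = ∑ σ : Config N, F σ :=
  (Equiv.arrowCongr e.symm (Equiv.refl Bool)).sum_comp F

lemma pairCorr_relabel (N : ℕ) (β : ℝ) (g : Fin N × Fin N → ℝ) (e : Equiv.Perm (Fin N))
    (i j : Fin N) :
    pairCorr N β (g ∘ pairRelabelEquiv e) i j = pairCorr N β g (e i) (e j) := by
  unfold pairCorr partFun
  rw [← sum_comp_perm e,
    ← sum_comp_perm e fun σ => Real.exp (ham N β (g ∘ pairRelabelEquiv e) σ)]
  simp only [ham_relabel, Function.comp_apply]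

lemma measurePreserving_gaussPi_comp (N : ℕ) (e : Equiv.Perm (Fin N × Fin N)) :
    MeasurePreserving (fun g : Fin N × Fin N → ℝ => g ∘ e) (gaussPi N) (gaussPi N) :=
  (measurePreserving_piCongrLeft (fun _ : Fin N × Fin N => gaussianReal 0 1) e).symm

/-- The mixture of two disorders with weights `√t` and `√(1−t)`. -/
def mixDisorder {N : ℕ} (t : ℝ) (g g' : Fin N × Fin N → ℝ) : Fin N × Fin N → ℝ :=
  fun p => √t * g p + √(1 - t) * g' p

lemma hamT_eq_ham (N : ℕ) (β t : ℝ) (g g' : Fin N × Fin N → ℝ) (σ : Config N) :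
    hamT N β t g g' σ = ham N β (mixDisorder t g g') σ := by
  simp only [hamT, ham, mixDisorder, add_mul, Finset.sum_add_distrib, mul_add, Finset.mul_sum]
  congr 1 <;> exact Finset.sum_congr rfl fun p _ => by ring

lemma measurePreserving_mix_gaussianReal {t : ℝ} (ht : t ∈ Set.Icc (0 : ℝ) 1) :
    MeasurePreserving (fun x : ℝ × ℝ => √t * x.1 + √(1 - t) * x.2)
      ((gaussianReal 0 1).prod (gaussianReal 0 1)) (gaussianReal 0 1) := by
  refine ⟨by fun_prop, ?_⟩
  have h₁ : MeasurePreserving (√t * ·) (gaussianReal 0 1)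
      (gaussianReal (√t * 0) (.mk (√t ^ 2) (sq_nonneg _) * 1)) :=
    ⟨by fun_prop, gaussianReal_map_const_mul _⟩
  have h₂ : MeasurePreserving (√(1 - t) * ·) (gaussianReal 0 1)
      (gaussianReal (√(1 - t) * 0) (.mk (√(1 - t) ^ 2) (sq_nonneg _) * 1)) :=
    ⟨by fun_prop, gaussianReal_map_const_mul _⟩
  have h := (h₁.prod h₂).map_eq
  have hconv := gaussianReal_conv_gaussianReal (m₁ := √t * 0) (m₂ := √(1 - t) * 0)
    (v₁ := .mk (√t ^ 2) (sq_nonneg _) * 1) (v₂ := .mk (√(1 - t) ^ 2) (sq_nonneg _) * 1)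
  rw [Measure.conv, ← h, Measure.map_map (by fun_prop) (by fun_prop)] at hconv
  refine hconv.trans ?_
  congr 1
  · simp
  · ext
    simp [Real.sq_sqrt ht.1, Real.sq_sqrt (sub_nonneg.2 ht.2)]

lemma measurePreserving_mixDisorder (N : ℕ) {t : ℝ} (ht : t ∈ Set.Icc (0 : ℝ) 1) :
    MeasurePreserving (fun x : (Fin N × Fin N → ℝ) × (Fin N × Fin N → ℝ) =>
      mixDisorder t x.1 x.2) ((gaussPi N).prod (gaussPi N)) (gaussPi N) :=
  (measurePreserving_pi _ _ fun _ : Fin N × Fin N => measurePreserving_mix_gaussianReal ht).comp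
    (measurePreserving_arrowProdEquivProdArrow ℝ ℝ (Fin N × Fin N)
      (fun _ => gaussianReal 0 1) (fun _ => gaussianReal 0 1)).symm

lemma continuous_mixDisorder (N : ℕ) (t : ℝ) :
    Continuous fun x : (Fin N × Fin N → ℝ) × (Fin N × Fin N → ℝ) => mixDisorder t x.1 x.2 := by
  unfold mixDisorder
  fun_prop

lemma gibbsT_pair (N : ℕ) (β t : ℝ) (g g' g'' : Fin N × Fin N → ℝ) (i j : Fin N) :
    gibbsT N β t g g' g''
        (fun ρ => spin (ρ.1 i) * spin (ρ.2 i) * (spin (ρ.1 j) * spin (ρ.2 j))) =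
      pairCorr N β (mixDisorder t g g') i j * pairCorr N β (mixDisorder t g g'') i j := by
  simp only [gibbsT, wT, hamT_eq_ham, pairCorr, partFun, Real.exp_add, Fintype.sum_prod_type]
  rw [div_mul_div_comm, Finset.sum_mul_sum, Finset.sum_mul_sum]
  congr 1
  exact Finset.sum_congr rfl fun σ _ => Finset.sum_congr rfl fun τ _ => by ring

lemma gibbsT_overlap_sq (N : ℕ) (β t : ℝ) (g g' g'' : Fin N × Fin N → ℝ) (S : Finset (Fin N)) :
    gibbsT N β t g g' g'' (fun ρ => ((∑ i ∈ S, spin (ρ.1 i) * spin (ρ.2 i)) / N) ^ 2) =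
      (∑ i ∈ S, ∑ j ∈ S, pairCorr N β (mixDisorder t g g') i j *
        pairCorr N β (mixDisorder t g g'') i j) / N ^ 2 := by
  simp only [← gibbsT_pair, gibbsT, div_pow, sq (∑ i ∈ S, _), Finset.sum_mul_sum]
  simp only [← Finset.sum_div, div_mul_eq_mul_div, Finset.sum_mul]
  rw [div_right_comm, Finset.sum_comm]
  simp only [Finset.sum_comm (s := (Finset.univ : Finset (Config N × Config N)))]

lemma gibbs2_overlap_sq (N : ℕ) (β : ℝ) (g : Fin N × Fin N → ℝ) :
    gibbs2 N β g (fun σ τ => ovlp N σ τ ^ 2) =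
      (∑ i, ∑ j, pairCorr N β g i j ^ 2) / N ^ 2 := by
  have h := gibbsT_overlap_sq N β 1 g g g Finset.univ
  have hmix : mixDisorder 1 g g = g := by
    ext p
    simp [mixDisorder]
  simp only [hmix, gibbsT, wT, hamT_eq_ham, Fintype.sum_prod_type, ← sq] at h
  rw [← h, gibbs2, partFun, sq, Finset.sum_mul_sum]
  simp only [ovlp, Real.exp_add]

/-- The disorder average `E⟨σ_i σ_j τ_i τ_j⟩_t` in the coupled system. -/
def coupledCorr (N : ℕ) (β t : ℝ) (i j : Fin N) : ℝ :=
  ∫ ω, pairCorr N β (mixDisorder t ω.1 ω.2.1) i j *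
    pairCorr N β (mixDisorder t ω.1 ω.2.2) i j ∂disM3 N

/-- The disorder average `E⟨σ_i σ_j⟩²` in the single system. -/
def sqCorr (N : ℕ) (β : ℝ) (i j : Fin N) : ℝ :=
  ∫ g, pairCorr N β g i j ^ 2 ∂gaussPi N

instance (N : ℕ) : IsProbabilityMeasure (disM3 N) := by
  unfold disM3; infer_instance

lemma integrable_pairCorr_mul_pairCorr {Ω : Type*} [TopologicalSpace Ω] [MeasurableSpace Ω]
    [OpensMeasurableSpace Ω] (μ : Measure Ω) [IsFiniteMeasure μ] (N : ℕ) (β : ℝ) (i j : Fin N)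
    {X Y : Ω → Fin N × Fin N → ℝ} (hX : Continuous X) (hY : Continuous Y) :
    Integrable (fun ω => pairCorr N β (X ω) i j * pairCorr N β (Y ω) i j) μ := by
  have hc := continuous_pairCorr N β i j
  refine Integrable.of_bound (C := 1)
    ((hc.comp hX).mul (hc.comp hY)).measurable.aestronglyMeasurable (ae_of_all _ fun ω => ?_)
  rw [Real.norm_eq_abs, abs_mul]
  exact mul_le_one₀ (abs_pairCorr_le_one ..) (abs_nonneg _) (abs_pairCorr_le_one ..)

lemma integrable_coupled (N : ℕ) (β t : ℝ) (i j : Fin N) :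
    Integrable (fun ω => pairCorr N β (mixDisorder t ω.1 ω.2.1) i j *
      pairCorr N β (mixDisorder t ω.1 ω.2.2) i j) (disM3 N) :=
  integrable_pairCorr_mul_pairCorr _ N β i j
    ((continuous_mixDisorder N t).comp (by fun_prop : Continuous fun ω :
      (Fin N × Fin N → ℝ) × (Fin N × Fin N → ℝ) × (Fin N × Fin N → ℝ) => (ω.1, ω.2.1)))
    ((continuous_mixDisorder N t).comp (by fun_prop : Continuous fun ω :
      (Fin N × Fin N → ℝ) × (Fin N × Fin N → ℝ) × (Fin N × Fin N → ℝ) => (ω.1, ω.2.2)))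

lemma integrable_pairCorr_sq (N : ℕ) (β : ℝ) (i j : Fin N) :
    Integrable (fun g => pairCorr N β g i j ^ 2) (gaussPi N) := by
  simpa only [sq, id] using
    integrable_pairCorr_mul_pairCorr (gaussPi N) N β i j continuous_id continuous_id

lemma EgibbsT_overlap_sq (N : ℕ) (β t : ℝ) (S : Finset (Fin N)) :
    EgibbsT N β t (fun ρ => ((∑ i ∈ S, spin (ρ.1 i) * spin (ρ.2 i)) / N) ^ 2) =
      (∑ i ∈ S, ∑ j ∈ S, coupledCorr N β t i j) / N ^ 2 := by
  simp only [EgibbsT, gibbsT_overlap_sq, integral_div]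
  rw [integral_finsetSum _ fun i _ => integrable_finsetSum _ fun j _ =>
    integrable_coupled N β t i j]
  congr 1
  exact Finset.sum_congr rfl fun i _ =>
    integral_finsetSum _ fun j _ => integrable_coupled N β t i j

lemma Egibbs2_overlap_sq (N : ℕ) (β : ℝ) :
    Egibbs2 N β (fun σ τ => ovlp N σ τ ^ 2) = (∑ i, ∑ j, sqCorr N β i j) / N ^ 2 := by
  simp only [Egibbs2, gibbs2_overlap_sq, integral_div]
  rw [integral_finsetSum _ fun i _ => integrable_finsetSum _ fun j _ =>
    integrable_pairCorr_sq N β i j]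
  congr 1
  exact Finset.sum_congr rfl fun i _ => integral_finsetSum _ fun j _ => integrable_pairCorr_sq N β i j

lemma coupledCorr_self (N : ℕ) (β t : ℝ) (i : Fin N) : coupledCorr N β t i i = 1 := by
  simp [coupledCorr, pairCorr_self]

lemma coupledCorr_comm (N : ℕ) (β t : ℝ) (i j : Fin N) :
    coupledCorr N β t i j = coupledCorr N β t j i := by
  simp only [coupledCorr, pairCorr_comm N β _ i j]

lemma sqCorr_self (N : ℕ) (β : ℝ) (i : Fin N) : sqCorr N β i i = 1 := by
  simp [sqCorr, pairCorr_self]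

lemma sqCorr_perm (N : ℕ) (β : ℝ) (e : Equiv.Perm (Fin N)) (i j : Fin N) :
    sqCorr N β (e i) (e j) = sqCorr N β i j := by
  have h := measurePreserving_gaussPi_comp N (pairRelabelEquiv e)
  simp only [sqCorr, ← pairCorr_relabel]
  conv_rhs => rw [← h.map_eq]
  exact (integral_map h.aemeasurable
    ((continuous_pairCorr N β i j).pow 2).measurable.aestronglyMeasurable).symm

lemma sum_sqCorr_eq (N : ℕ) (β : ℝ) (k : Fin N) :
    ∑ i, ∑ j, sqCorr N β i j = N * ∑ i, sqCorr N β i k := by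
  have h (j : Fin N) : ∑ i, sqCorr N β i j = ∑ i, sqCorr N β i k := by
    rw [← Equiv.sum_comp (Equiv.swap k j)]
    refine Finset.sum_congr rfl fun i _ => ?_
    conv_rhs => rw [← sqCorr_perm N β (Equiv.swap k j), Equiv.swap_apply_left]
  rw [Finset.sum_comm, Finset.sum_congr rfl fun j _ => h j]
  simp

lemma coupledCorr_nonneg (N : ℕ) (β t : ℝ) (i j : Fin N) : 0 ≤ coupledCorr N β t i j := by
  have h := integrable_coupled N β t i j
  unfold disM3 at h
  rw [coupledCorr, disM3, integral_prod _ h]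
  refine integral_nonneg fun g => ?_
  simp only
  rw [integral_prod_mul (fun g' => pairCorr N β (mixDisorder t g g') i j)
    (fun g'' => pairCorr N β (mixDisorder t g g'') i j)]
  exact mul_self_nonneg _

lemma coupledCorr_le_sqCorr (N : ℕ) (β : ℝ) {t : ℝ} (ht : t ∈ Set.Icc (0 : ℝ) 1)
    (i j : Fin N) : coupledCorr N β t i j ≤ sqCorr N β i j := by
  have hfst : MeasurePreserving (fun ω : (Fin N × Fin N → ℝ) × (Fin N × Fin N → ℝ) ×
      (Fin N × Fin N → ℝ) => mixDisorder t ω.1 ω.2.1) (disM3 N) (gaussPi N) :=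
    (measurePreserving_mixDisorder N ht).comp
      ((MeasurePreserving.id (gaussPi N)).prod measurePreserving_fst)
  have hsnd : MeasurePreserving (fun ω : (Fin N × Fin N → ℝ) × (Fin N × Fin N → ℝ) ×
      (Fin N × Fin N → ℝ) => mixDisorder t ω.1 ω.2.2) (disM3 N) (gaussPi N) :=
    (measurePreserving_mixDisorder N ht).comp
      ((MeasurePreserving.id (gaussPi N)).prod measurePreserving_snd)
  have hmeas : StronglyMeasurable fun g => pairCorr N β g i j ^ 2 :=
    ((continuous_pairCorr N β i j).pow 2).measurable.stronglyMeasurable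
  have hint := integrable_pairCorr_sq N β i j
  have hI {X : _ → Fin N × Fin N → ℝ} (hX : MeasurePreserving X (disM3 N) (gaussPi N)) :
      ∫ ω, pairCorr N β (X ω) i j ^ 2 ∂disM3 N = sqCorr N β i j := by
    rw [sqCorr, ← hX.map_eq]
    exact (integral_map hX.aemeasurable hmeas.aestronglyMeasurable).symm
  have hi₁ := hfst.integrable_comp_of_integrable hint
  have hi₂ := hsnd.integrable_comp_of_integrable hint
  have hle := integral_mono (μ := disM3 N) ((integrable_coupled N β t i j).const_mul 2)
    (hi₁.add hi₂) fun ω => by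
      simpa [mul_assoc] using two_mul_le_add_sq
        (pairCorr N β (mixDisorder t ω.1 ω.2.1) i j) (pairCorr N β (mixDisorder t ω.1 ω.2.2) i j)
  rw [integral_const_mul, integral_add' hi₁ hi₂] at hle
  have h₁ := hI hfst
  have h₂ := hI hsnd
  simp only [Function.comp_def] at hle
  unfold coupledCorr
  linarith

/-- `0 ≤ E⟨R(σ,τ)²⟩_t − E⟨R⁻(σ,τ)²⟩_t ≤ (2/N)·E⟨R(σ¹,σ²)²⟩`. -/
theorem sk_overlap_truncation_error (N : ℕ) (hN : 1 ≤ N) (β : ℝ) (hβ : 0 < β)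
    (t : ℝ) (ht : t ∈ Set.Icc (0 : ℝ) 1) :
    0 ≤ EgibbsT N β t (fun ρ => ovlp N ρ.1 ρ.2 ^ 2) -
        EgibbsT N β t (fun ρ => ovlpm N ρ.1 ρ.2 ^ 2) ∧
      EgibbsT N β t (fun ρ => ovlp N ρ.1 ρ.2 ^ 2) -
          EgibbsT N β t (fun ρ => ovlpm N ρ.1 ρ.2 ^ 2) ≤
        2 / N * Egibbs2 N β (fun σ τ => ovlp N σ τ ^ 2) := by
  have hN' : (0 : ℝ) < N := by exact_mod_cast hN
  let k : Fin N := ⟨N - 1, Nat.sub_lt hN Nat.one_pos⟩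
  set S : Finset (Fin N) := Finset.univ.filter fun i : Fin N => (i : ℕ) < N - 1 with hS
  have hkS : k ∉ S := by simp [hS, k]
  have huniv : (Finset.univ : Finset (Fin N)) = insert k S := by
    ext i
    simp only [hS, k, Finset.mem_univ, Finset.mem_insert, Finset.mem_filter, true_and, true_iff,
      Fin.ext_iff]
    omega
  have hdiff : EgibbsT N β t (fun ρ => ovlp N ρ.1 ρ.2 ^ 2) -
      EgibbsT N β t (fun ρ => ovlpm N ρ.1 ρ.2 ^ 2) =
        (1 + 2 * ∑ i ∈ S, coupledCorr N β t i k) / N ^ 2 := by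
    have h₁ : EgibbsT N β t (fun ρ => ovlp N ρ.1 ρ.2 ^ 2) =
        (∑ i, ∑ j, coupledCorr N β t i j) / N ^ 2 := EgibbsT_overlap_sq N β t Finset.univ
    have h₂ : EgibbsT N β t (fun ρ => ovlpm N ρ.1 ρ.2 ^ 2) =
        (∑ i ∈ S, ∑ j ∈ S, coupledCorr N β t i j) / N ^ 2 := EgibbsT_overlap_sq N β t S
    rw [h₁, h₂, ← sub_div, huniv]
    simp only [Finset.sum_insert hkS, Finset.sum_add_distrib, coupledCorr_self,
      coupledCorr_comm N β t k]
    ring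
  have hright : 2 / N * Egibbs2 N β (fun σ τ => ovlp N σ τ ^ 2) =
      (2 + 2 * ∑ i ∈ S, sqCorr N β i k) / N ^ 2 := by
    rw [Egibbs2_overlap_sq, sum_sqCorr_eq N β k, huniv, Finset.sum_insert hkS, sqCorr_self]
    field_simp
  have hnonneg : 0 ≤ ∑ i ∈ S, coupledCorr N β t i k :=
    Finset.sum_nonneg fun i _ => coupledCorr_nonneg N β t i k
  have hle : ∑ i ∈ S, coupledCorr N β t i k ≤ ∑ i ∈ S, sqCorr N β i k :=
    Finset.sum_le_sum fun i _ => coupledCorr_le_sqCorr N β ht i k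
  rw [hdiff, hright]
  refine ⟨by positivity, ?_⟩
  gcongr
  norm_num

end
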